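/- Let k be a field, V a 3-dimensional k-vector space, Λ ⊆ End(V) a 4-dimensional subspace, and Λ^⊥ its orthogonal complement with respect to the trace pairing. If σ ∈ Λ has rank 2, then the subspace {φ ∈ Λ^⊥ : σ∘φ∘σ = 0} has dimension at least 2. -/

import Mathlib

open LinearMap in
/-- The submodule `{φ ∈ Λ^⊥ : σ∘φ∘σ = 0}` of `End(V)` (where `Λ^⊥` is the orthogonal
complement of `Λ` with respect to the trace pairing). -/
def perpCut (k V : Type*) [Field k] [AddCommGroup V] [Module k V] [FiniteDimensional k V]
    (Λ : Submodule k (V →ₗ[k] V)) (σ : V →ₗ[k] V) : Submodule k (V →ₗ[k] V) where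
  carrier := {φ | (∀ M ∈ Λ, LinearMap.trace k V (M ∘ₗ φ) = 0) ∧ σ ∘ₗ φ ∘ₗ σ = 0}
  zero_mem' := by
    refine ⟨fun M _ => ?_, ?_⟩ <;> simp
  add_mem' := by
    rintro a b ⟨ha1, ha2⟩ ⟨hb1, hb2⟩
    refine ⟨fun M hM => ?_, ?_⟩
    · rw [LinearMap.comp_add, map_add, ha1 M hM, hb1 M hM, add_zero]
    · rw [LinearMap.add_comp, LinearMap.comp_add, ha2, hb2, add_zero]
  smul_mem' := by
    rintro c a ⟨ha1, ha2⟩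
    refine ⟨fun M hM => ?_, ?_⟩
    · rw [LinearMap.comp_smul, map_smul, ha1 M hM, smul_zero]
    · rw [LinearMap.smul_comp, LinearMap.comp_smul, ha2, smul_zero]

/-- If `σ ∘ φ ∘ σ = 0`, then `σ ∘ φ` is nilpotent and hence has trace zero. -/
theorem trace_comp_eq_zero_of_comp_comp_eq_zero {k V : Type*} [Field k] [AddCommGroup V]
    [Module k V] {σ φ : V →ₗ[k] V} (h : σ ∘ₗ φ ∘ₗ σ = 0) :
    LinearMap.trace k V (σ ∘ₗ φ) = 0 := by
  have hn : IsNilpotent (σ ∘ₗ φ) := by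
    refine ⟨2, LinearMap.ext fun v => ?_⟩
    simpa [pow_two] using LinearMap.congr_fun h (φ v)
  exact (LinearMap.isNilpotent_trace_of_isNilpotent hn).eq_zero

/-- The compression `φ ↦ σ ∘ φ|_{range σ}`, as a map from `End(V)` to `End(range σ)`. -/
noncomputable def rangeCompression {k V : Type*} [Field k] [AddCommGroup V] [Module k V]
    (σ : V →ₗ[k] V) : (V →ₗ[k] V) →ₗ[k] (LinearMap.range σ →ₗ[k] LinearMap.range σ) :=
  LinearMap.compRight k σ.rangeRestrict ∘ₗ LinearMap.lcomp k V (LinearMap.range σ).subtype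

theorem comp_comp_eq_zero_of_mem_ker_rangeCompression {k V : Type*} [Field k]
    [AddCommGroup V] [Module k V] {σ φ : V →ₗ[k] V}
    (h : φ ∈ LinearMap.ker (rangeCompression σ)) : σ ∘ₗ φ ∘ₗ σ = 0 := by
  ext v
  exact congrArg Subtype.val (LinearMap.congr_fun h (σ.rangeRestrict v))

/-- The map `End(V) → Λ*` induced by the trace pairing. -/
noncomputable def traceDual {k V : Type*} [Field k] [AddCommGroup V] [Module k V]
    (Λ : Submodule k (V →ₗ[k] V)) : (V →ₗ[k] V) →ₗ[k] Module.Dual k Λ :=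
  (((LinearMap.mul k (Module.End k V)).compr₂ (LinearMap.trace k V)).domRestrict Λ).flip

theorem traceDual_apply {k V : Type*} [Field k] [AddCommGroup V] [Module k V]
    (Λ : Submodule k (V →ₗ[k] V)) (φ : V →ₗ[k] V) (M : Λ) :
    traceDual Λ φ M = LinearMap.trace k V (M.1 ∘ₗ φ) := rfl

/-- If `dim V = 3`, `Λ ⊂ End(V)` has dimension 4 and `σ ∈ Λ` has rank 2, then the
subspace `{φ ∈ Λ^⊥ : σ∘φ∘σ = 0}` has dimension at least 2. -/
theorem stmt5 (k V : Type*) [Field k] [AddCommGroup V] [Module k V]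
    [FiniteDimensional k V] (hV : Module.finrank k V = 3)
    (Λ : Submodule k (V →ₗ[k] V)) (hΛ : Module.finrank k Λ = 4)
    (σ : V →ₗ[k] V) (hσΛ : σ ∈ Λ)
    (hσ : Module.finrank k (LinearMap.range σ) = 2) :
    2 ≤ Module.finrank k (perpCut k V Λ σ) := by
  set K := LinearMap.ker (rangeCompression σ)
  set E := (traceDual Λ).domRestrict K
  have hK : 5 ≤ Module.finrank k K := by
    have h₁ : _ + Module.finrank k K = _ := (rangeCompression σ).finrank_range_add_finrank_ker
    have h₂ := Submodule.finrank_le (LinearMap.range (rangeCompression σ))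
    rw [Module.finrank_linearMap, hσ] at h₂
    rw [Module.finrank_linearMap, hV] at h₁
    omega
  have hE : Module.finrank k (LinearMap.range E) ≤ 3 := by
    have hσ0 : (⟨σ, hσΛ⟩ : Λ) ≠ 0 := by
      intro h
      have h0 : σ = 0 := congrArg Subtype.val h
      rw [h0, LinearMap.range_zero, finrank_bot] at hσ
      omega
    have hle : LinearMap.range E ≤ (k ∙ (⟨σ, hσΛ⟩ : Λ)).dualAnnihilator := by
      rintro _ ⟨φ, rfl⟩
      rw [Submodule.mem_dualAnnihilator]
      intro w hw
      obtain ⟨c, rfl⟩ := Submodule.mem_span_singleton.mp hw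
      rw [map_smul, LinearMap.domRestrict_apply, traceDual_apply,
        trace_comp_eq_zero_of_comp_comp_eq_zero
          (comp_comp_eq_zero_of_mem_ker_rangeCompression φ.2), smul_zero]
    have h₁ := Submodule.finrank_mono hle
    have h₂ := Subspace.finrank_add_finrank_dualAnnihilator_eq (k ∙ (⟨σ, hσΛ⟩ : Λ))
    rw [finrank_span_singleton hσ0, hΛ] at h₂
    omega
  have hle : (LinearMap.ker E).map K.subtype ≤ perpCut k V Λ σ := by
    rintro _ ⟨φ, hφ, rfl⟩
    exact ⟨fun M hM => LinearMap.congr_fun hφ ⟨M, hM⟩,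
      comp_comp_eq_zero_of_mem_ker_rangeCompression φ.2⟩
  have h₁ := Submodule.finrank_mono hle
  rw [Submodule.finrank_map_subtype_eq] at h₁
  have h₂ := E.finrank_range_add_finrank_ker
  omega
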